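/- For every λ ∈ [0,1] and every positive integer k, the k-fold Minkowski sum k × S_λ has Hausdorff dimension dim(k × S_λ) = (1−λ)/(1+λ), and C_{(1−λ)/(1+λ)}(k × S_λ) = 0. -/

import Mathlib

open MeasureTheory Real Set Filter Topology ENNReal

noncomputable section

/-- The index set `K_λ^k = {m ∈ ℕ : ∃ j ∈ ℕ*, 2^j ≤ m ≤ 2^j(1+λ+1/j) - k + 1}`. -/
def Kset (lam : ℝ) (k : ℕ) : Set ℕ :=
  {m | ∃ j : ℕ, 0 < j ∧ (2 : ℝ) ^ j ≤ (m : ℝ) ∧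
    (m : ℝ) ≤ (2 : ℝ) ^ j * (1 + lam + 1 / (j : ℝ)) - (k : ℝ) + 1}

/-- The Cantor-type set `S_λ^k ⊆ ℝ/ℤ`: binary expansions `x = ∑ x_i 2^{-(i+1)}`
with digits `x_i ∈ {0,1}` vanishing on `K_λ^k`. -/
def Sset (lam : ℝ) (k : ℕ) : Set (AddCircle (1 : ℝ)) :=
  {y | ∃ x : ℕ → ℕ, (∀ i, x i ≤ 1) ∧ (∀ i ∈ Kset lam k, x i = 0) ∧
    y = ((∑' i : ℕ, (x i : ℝ) / 2 ^ (i + 1) : ℝ) : AddCircle (1 : ℝ))}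

/-- The `k`-fold Minkowski sum `k × E = E + ⋯ + E` in `ℝ/ℤ`. -/
def kFold1 (k : ℕ) (E : Set (AddCircle (1 : ℝ))) : Set (AddCircle (1 : ℝ)) :=
  {x | ∃ g : Fin k → AddCircle (1 : ℝ), (∀ i, g i ∈ E) ∧ x = ∑ i, g i}

/-- Fourier coefficient `μ̂(n)` of a measure on `ℝ/ℤ`. -/
def muHat1 (μ : Measure (AddCircle (1 : ℝ))) (n : ℤ) : ℂ :=
  ∫ t, fourier (-n) t ∂μ

/-- The `α`-energy `I_α(μ) = ∑_{n ≥ 1} |μ̂(n)|²/(1+n)^{1-α}` of `μ` is finite. -/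
def HasFiniteEnergy1 (α : ℝ) (μ : Measure (AddCircle (1 : ℝ))) : Prop :=
  Summable fun n : ℕ => ‖muHat1 μ (n + 1)‖ ^ 2 / (1 + ((n : ℝ) + 1)) ^ (1 - α)

/-- `C_α(E) = 0`: every probability measure supported on a compact subset of `E`
has infinite `α`-energy. -/
def CapacityZero1 (α : ℝ) (E : Set (AddCircle (1 : ℝ))) : Prop :=
  ∀ μ : Measure (AddCircle (1 : ℝ)), IsProbabilityMeasure μ →
    (∃ K, K ⊆ E ∧ IsCompact K ∧ μ Kᶜ = 0) → ¬ HasFiniteEnergy1 α μ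

/-- Integer formed by the first `n` binary digits. -/
def av (x : ℕ → ℕ) : ℕ → ℕ
  | 0 => 0
  | n + 1 => 2 * av x n + x n

/-- Real value of a digit sequence. -/
def vv (x : ℕ → ℕ) : ℝ := ∑' i : ℕ, (x i : ℝ) / 2 ^ (i + 1)

lemma av_lt (x : ℕ → ℕ) (hx : ∀ i, x i ≤ 1) (n : ℕ) : av x n < 2 ^ n := by
  induction n with
  | zero => simp [av]
  | succ n ih => have := hx n; simp only [av, pow_succ]; omega

lemma av_add (x : ℕ → ℕ) (n m : ℕ) :
    av x (n + m) = 2 ^ m * av x n + av (fun i => x (n + i)) m := by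
  induction m with
  | zero => simp [av]
  | succ m ih => rw [← add_assoc]; simp only [av, ih, pow_succ]; ring

lemma av_zero (x : ℕ → ℕ) (n : ℕ) (h : ∀ i < n, x i = 0) : av x n = 0 := by
  induction n with
  | zero => simp [av]
  | succ n ih =>
    simp only [av, h n (Nat.lt_succ_self n), ih (fun i hi => h i (by omega))]

lemma av_inj (x y : ℕ → ℕ) (hx : ∀ i, x i ≤ 1) (hy : ∀ i, y i ≤ 1) (n : ℕ)
    (h : av x n = av y n) : ∀ i < n, x i = y i := by
  induction n with
  | zero => simp
  | succ n ih =>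
    simp only [av] at h
    have h1 := hx n
    have h2 := hy n
    intro i hi
    rcases Nat.lt_succ_iff_lt_or_eq.mp hi with h3 | h3
    · exact ih (by omega) i h3
    · subst h3; omega

lemma hasSum_half : HasSum (fun i : ℕ => (1 : ℝ) / 2 ^ (i + 1)) 1 := by
  have := hasSum_geometric_two' 1
  convert this using 2 with i
  rw [pow_succ]; field_simp

lemma vv_summable (x : ℕ → ℕ) (hx : ∀ i, x i ≤ 1) :
    Summable (fun i : ℕ => (x i : ℝ) / 2 ^ (i + 1)) := by
  refine Summable.of_nonneg_of_le (fun i => by positivity) (fun i => ?_) hasSum_half.summable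
  have : (x i : ℝ) ≤ 1 := by exact_mod_cast hx i
  gcongr

lemma vv_nonneg (x : ℕ → ℕ) : 0 ≤ vv x := tsum_nonneg (fun i => by positivity)

lemma vv_le_one (x : ℕ → ℕ) (hx : ∀ i, x i ≤ 1) : vv x ≤ 1 := by
  rw [vv, ← hasSum_half.tsum_eq]
  refine (vv_summable x hx).tsum_le_tsum (fun i => ?_) hasSum_half.summable
  have : (x i : ℝ) ≤ 1 := by exact_mod_cast hx i
  gcongr

lemma vv_step (x : ℕ → ℕ) (hx : ∀ i, x i ≤ 1) :
    vv x = ((x 0 : ℝ) + vv (fun i => x (i + 1))) / 2 := by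
  rw [vv, (vv_summable x hx).tsum_eq_zero_add, vv, add_div, ← tsum_div_const]
  congr 1
  · simp
  · refine tsum_congr fun i => ?_
    rw [pow_succ (2 : ℝ) (i + 1)]; field_simp

lemma vv_split (x : ℕ → ℕ) (hx : ∀ i, x i ≤ 1) (n : ℕ) :
    vv x = ((av x n : ℝ) + vv (fun i => x (n + i))) / 2 ^ n := by
  induction n with
  | zero => simp [av]
  | succ n ih =>
    rw [ih, vv_step (fun i => x (n + i)) (fun i => hx _)]
    have : (fun i => x (n + (i + 1))) = (fun i => x (n + 1 + i)) := by
      funext i; congr 1; ring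
    rw [this]
    simp only [av, pow_succ, add_zero]
    push_cast
    field_simp
    ring

lemma mem_K (lam : ℝ) (j : ℕ) (hj : 0 < j) (i : ℕ) (h : 2 ^ j ≤ i)
    (h' : i < ⌊(2:ℝ) ^ j * (1 + lam + 1 / (j : ℝ))⌋₊ + 1) : i ∈ Kset lam 1 := by
  refine ⟨j, hj, by exact_mod_cast h, ?_⟩
  have hpos : 0 < 2 ^ j := by positivity
  have h2 : i ≤ ⌊(2:ℝ) ^ j * (1 + lam + 1 / (j : ℝ))⌋₊ := by omega
  have := (Nat.le_floor_iff' (by omega)).1 h2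
  push_cast
  linarith

lemma tendsto_pow_div : Tendsto (fun j : ℕ => (2:ℝ) ^ j / (j : ℝ)) atTop atTop := by
  have h := tendsto_pow_const_div_const_pow_of_one_lt 1 (r := (2:ℝ)) (by norm_num)
  have h2 : Tendsto (fun j : ℕ => (j:ℝ) ^ 1 / (2:ℝ) ^ j) atTop (𝓝[>] 0) := by
    refine tendsto_nhdsWithin_iff.2 ⟨h, ?_⟩
    filter_upwards [eventually_gt_atTop 0] with j hj
    have : (0:ℝ) < j := by exact_mod_cast hj
    simp only [mem_Ioi]; positivity
  refine h2.inv_tendsto_nhdsGT_zero.congr fun j => ?_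
  simp

lemma exists_sum_set (lam : ℝ) (h0 : 0 ≤ lam) (h1 : lam < 1) (k : ℕ) (hk : 0 < k) :
    ∃ C : ℝ, 0 < C ∧ ∃ J : ℕ, ∀ j ≥ J, ∃ A : Finset ℕ,
      (A.card : ℝ) ≤ C * (2:ℝ) ^ ((1 - lam) * 2 ^ j) ∧
      ∀ x : Fin k → ℕ → ℕ, (∀ l i, x l i ≤ 1) → (∀ l, ∀ i ∈ Kset lam 1, x l i = 0) →
        ∑ l, av (x l) (2 ^ j) ∈ A := by
  have e1 : ∀ᶠ j : ℕ in atTop, (k : ℝ) ≤ (2:ℝ) ^ j / (j : ℝ) :=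
    tendsto_pow_div.eventually_ge_atTop _
  have e2 : ∀ᶠ j : ℕ in atTop, 1 / (j : ℝ) < 1 - lam :=
    tendsto_one_div_atTop_nhds_zero_nat.eventually_lt_const (by linarith)
  obtain ⟨J, hJ⟩ := eventually_atTop.1 ((e1.and e2).and (eventually_gt_atTop 0))
  refine ⟨(k * 2 ^ (2 ^ J) + 1 : ℕ), by positivity, J, ?_⟩
  intro j hj
  induction j, hj using Nat.le_induction with
  | base =>
    refine ⟨Finset.range (k * 2 ^ (2 ^ J) + 1), ?_, ?_⟩
    · rw [Finset.card_range]
      refine le_mul_of_one_le_right (by positivity) ?_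
      refine Real.one_le_rpow (by norm_num) ?_
      have : 0 ≤ 1 - lam := by linarith
      positivity
    · intro x hx _
      rw [Finset.mem_range, Nat.lt_succ_iff]
      calc ∑ l, av (x l) (2 ^ J) ≤ ∑ l : Fin k, 2 ^ (2 ^ J) :=
            Finset.sum_le_sum fun l _ => (av_lt _ (hx l) _).le
        _ = _ := by simp
  | succ j hj ih =>
    obtain ⟨A, hA, hA'⟩ := ih
    obtain ⟨⟨hk1, hl⟩, hj0⟩ := hJ j hj
    set q := ⌊(2:ℝ) ^ j * (1 + lam + 1 / (j : ℝ))⌋₊ + 1 with hq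
    have hjr : (0:ℝ) < j := by exact_mod_cast hj0
    have h2j : (0:ℝ) < 2 ^ j := by positivity
    have hjinv : 0 < 1 / (j:ℝ) := by positivity
    have hq1 : q ≤ 2 ^ (j + 1) := by
      have : ⌊(2:ℝ) ^ j * (1 + lam + 1 / (j : ℝ))⌋₊ < 2 ^ (j + 1) := by
        rw [Nat.floor_lt (by positivity)]
        push_cast
        rw [pow_succ]
        refine mul_lt_mul_of_pos_left (by linarith) h2j
      omega
    have hq2 : (2:ℝ) ^ j * (1 + lam + 1 / (j : ℝ)) < q := by
      have := Nat.lt_floor_add_one ((2:ℝ) ^ j * (1 + lam + 1 / (j : ℝ)))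
      rw [hq]; push_cast; exact this
    have hq3 : 2 ^ j ≤ q := by
      have : ((2 ^ j : ℕ) : ℝ) ≤ q := by
        push_cast
        nlinarith
      exact_mod_cast this
    obtain ⟨L, hL⟩ := Nat.exists_eq_add_of_le hq1
    obtain ⟨Z, hZ⟩ := Nat.exists_eq_add_of_le hq3
    refine ⟨(A ×ˢ Finset.range (k * 2 ^ L)).image (fun p => 2 ^ (Z + L) * p.1 + p.2), ?_, ?_⟩
    · have hc : (((A ×ˢ Finset.range (k * 2 ^ L)).image
          (fun p => 2 ^ (Z + L) * p.1 + p.2)).card : ℝ) ≤ A.card * (k * 2 ^ L) := by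
        have := Finset.card_image_le (s := A ×ˢ Finset.range (k * 2 ^ L))
          (f := fun p => 2 ^ (Z + L) * p.1 + p.2)
        rw [Finset.card_product, Finset.card_range] at this
        exact_mod_cast this
      refine hc.trans ?_
      have hkL : (k : ℝ) * 2 ^ L ≤ (2:ℝ) ^ ((1 - lam) * 2 ^ j) := by
        have a1 : (k : ℝ) ≤ (2:ℝ) ^ ((2:ℝ) ^ j / (j : ℝ)) := by
          have b1 : (k:ℝ) ≤ (2:ℝ) ^ (k:ℝ) := by
            rw [Real.rpow_natCast]; exact_mod_cast Nat.lt_two_pow_self.le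
          exact b1.trans (Real.rpow_le_rpow_of_exponent_le (by norm_num) hk1)
        have a2 : (2:ℝ) ^ L ≤ (2:ℝ) ^ ((1 - lam) * 2 ^ j - (2:ℝ) ^ j / (j : ℝ)) := by
          rw [← Real.rpow_natCast]
          refine Real.rpow_le_rpow_of_exponent_le (by norm_num) ?_
          have : ((2:ℝ) ^ (j + 1)) = q + L := by exact_mod_cast hL
          rw [pow_succ] at this
          have e : (2:ℝ) ^ j * (1 + lam + 1 / (j : ℝ))
            = 2 ^ j + 2 ^ j * lam + (2:ℝ) ^ j / (j : ℝ) := by ring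
          nlinarith
        calc (k : ℝ) * 2 ^ L ≤ _ * _ := mul_le_mul a1 a2 (by positivity) (by positivity)
          _ = _ := by rw [← Real.rpow_add (by norm_num)]; congr 1; ring
      calc (A.card : ℝ) * (k * 2 ^ L) ≤ _ * _ :=
            mul_le_mul hA hkL (by positivity) (by positivity)
        _ = _ := by
            rw [mul_assoc, ← Real.rpow_add (by norm_num)]; congr 2; rw [pow_succ]; ring
    · intro x hx hx0
      rw [Finset.mem_image]
      refine ⟨(∑ l, av (x l) (2 ^ j), ∑ l, av (fun i => x l (q + i)) L), ?_, ?_⟩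
      · rw [Finset.mem_product]
        refine ⟨hA' x hx hx0, ?_⟩
        rw [Finset.mem_range]
        calc ∑ l, av (fun i => x l (q + i)) L < ∑ l : Fin k, 2 ^ L := by
              refine Finset.sum_lt_sum_of_nonempty ⟨⟨0, hk⟩, Finset.mem_univ _⟩ fun l _ => ?_
              exact av_lt _ (fun i => hx l _) _
          _ = _ := by simp
      · simp only
        rw [Finset.mul_sum, ← Finset.sum_add_distrib]
        refine Finset.sum_congr rfl fun l _ => ?_
        have z : av (x l) q = 2 ^ Z * av (x l) (2 ^ j) := by
          rw [hZ, av_add, av_zero (fun i => x l (2 ^ j + i)) Z, add_zero]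
          intro i hi
          exact hx0 l _ (mem_K lam j hj0 _ (by omega) (by rw [← hq]; omega))
        rw [hL, av_add, z, pow_add]; ring

lemma norm_fourier_sum_ge (M : ℕ) (hM : 0 < M) (t : AddCircle (1 : ℝ))
    (ht : ‖t‖ ≤ 1 / (6 * M)) :
    (M : ℝ) / 2 ≤ ‖∑ a ∈ Finset.range M, (fourier (a : ℤ) t : ℂ)‖ := by
  obtain ⟨s, hs, hst⟩ : ∃ s : ℝ, |s| ≤ 1 / (6 * M) ∧ (s : AddCircle (1:ℝ)) = t := by
    induction t using QuotientAddGroup.induction_on with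
    | H z =>
      refine ⟨z - round z, ?_, ?_⟩
      · have := AddCircle.norm_eq (p := 1) (x := z)
        simp only [inv_one, one_mul, mul_one] at this
        rw [← this]; exact ht
      · rw [AddCircle.coe_sub]
        have : ((round z : ℝ) : AddCircle (1:ℝ)) = 0 := by
          rw [AddCircle.coe_eq_zero_iff]; exact ⟨round z, by simp⟩
        rw [this, sub_zero]
  refine le_trans ?_ (Complex.re_le_norm _)
  rw [Complex.re_sum]
  have hMr : (0:ℝ) < M := by exact_mod_cast hM
  calc (M : ℝ) / 2 = ∑ a ∈ Finset.range M, (1/2 : ℝ) := by simp [div_eq_mul_inv]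
    _ ≤ _ := by
      refine Finset.sum_le_sum fun a ha => ?_
      rw [Finset.mem_range] at ha
      have har : (a : ℝ) ≤ M := by exact_mod_cast ha.le
      rw [← hst, fourier_coe_apply]
      have e : (2 * (π:ℂ) * Complex.I * ((a:ℤ):ℂ) * (s:ℂ) / ((1:ℝ):ℂ))
          = ((2 * π * a * s : ℝ) : ℂ) * Complex.I := by
        push_cast; ring
      rw [e, Complex.exp_ofReal_mul_I_re, ← Real.cos_abs, ← Real.cos_pi_div_three]
      refine Real.cos_le_cos_of_nonneg_of_le_pi (abs_nonneg _) (by linarith [Real.pi_pos]) ?_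
      rw [abs_mul, abs_of_nonneg (by positivity : 0 ≤ 2 * π * (a:ℝ))]
      calc 2 * π * a * |s| ≤ 2 * π * M * (1 / (6 * M)) := by gcongr
        _ = π / 3 := by field_simp; ring

lemma sum_natAbs_le (h : ℕ → ℝ) (hh : ∀ n, 0 ≤ h n) (M a : ℕ) (ha : a < M) :
    ∑ b ∈ Finset.range M, h ((a : ℤ) - b).natAbs
      ≤ h 0 + 2 * ∑ n ∈ Finset.range (M - 1), h (n + 1) := by
  have e1 : ∑ b ∈ Finset.range a, h ((a : ℤ) - b).natAbs = ∑ n ∈ Finset.range a, h (n + 1) := by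
    rw [← Finset.sum_range_reflect]
    refine Finset.sum_congr rfl fun b hb => ?_
    rw [Finset.mem_range] at hb
    congr 1; omega
  have e2 : ∑ b ∈ Finset.Ico a M, h ((a : ℤ) - b).natAbs
      = h 0 + ∑ n ∈ Finset.range (M - a - 1), h (n + 1) := by
    rw [Finset.sum_Ico_eq_sum_range]
    obtain ⟨r, hr⟩ : ∃ r, M - a = r + 1 := ⟨M - a - 1, by omega⟩
    rw [hr, Finset.sum_range_succ']
    have : ∀ n : ℕ, ((a : ℤ) - ((a + n : ℕ) : ℤ)).natAbs = n := fun n => by omega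
    simp only [this]
    rw [add_comm]; rfl
  have e3 : ∑ n ∈ Finset.range a, h (n + 1) ≤ ∑ n ∈ Finset.range (M - 1), h (n + 1) :=
    Finset.sum_le_sum_of_subset_of_nonneg (Finset.range_subset_range.2 (by omega))
      fun _ _ _ => hh _
  have e4 : ∑ n ∈ Finset.range (M - a - 1), h (n + 1)
      ≤ ∑ n ∈ Finset.range (M - 1), h (n + 1) :=
    Finset.sum_le_sum_of_subset_of_nonneg (Finset.range_subset_range.2 (by omega))
      fun _ _ _ => hh _
  have := Finset.sum_range_add_sum_Ico (fun b : ℕ => h ((a : ℤ) - b).natAbs) ha.le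
  rw [← this, e1, e2]
  linarith

lemma muHat_neg (μ : Measure (AddCircle (1 : ℝ))) (n : ℤ) :
    muHat1 μ (-n) = (starRingEnd ℂ) (muHat1 μ n) := by
  unfold muHat1
  rw [← integral_conj]
  simp

lemma norm_muHat_natAbs (μ : Measure (AddCircle (1 : ℝ))) (n : ℤ) :
    ‖muHat1 μ n‖ = ‖muHat1 μ (n.natAbs : ℤ)‖ := by
  rcases Int.natAbs_eq n with h | h
  · rw [← h]
  · conv_lhs => rw [h, muHat_neg]
    simp

lemma fourier_integrable (μ : Measure (AddCircle (1 : ℝ))) [IsProbabilityMeasure μ] (n : ℤ) :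
    Integrable (fun t => (fourier n t : ℂ)) μ := by
  refine Integrable.of_bound (fourier n).continuous.aestronglyMeasurable 1 ?_
  filter_upwards with t
  rw [fourier_apply, Circle.norm_coe]

lemma kernel_integral (μ : Measure (AddCircle (1 : ℝ))) [IsProbabilityMeasure μ] (M : ℕ) :
    Integrable (fun p : AddCircle (1:ℝ) × AddCircle (1:ℝ) =>
      ‖∑ a ∈ Finset.range M, (fourier (a : ℤ) (p.1 - p.2) : ℂ)‖ ^ 2) (μ.prod μ) ∧
    ∫ p : AddCircle (1:ℝ) × AddCircle (1:ℝ),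
      ‖∑ a ∈ Finset.range M, (fourier (a : ℤ) (p.1 - p.2) : ℂ)‖ ^ 2 ∂(μ.prod μ)
    = ∑ a ∈ Finset.range M, ∑ b ∈ Finset.range M, ‖muHat1 μ ((a : ℤ) - b)‖ ^ 2 := by
  have key : ∀ p : AddCircle (1:ℝ) × AddCircle (1:ℝ),
      ((‖∑ a ∈ Finset.range M, (fourier (a : ℤ) (p.1 - p.2) : ℂ)‖ ^ 2 : ℝ) : ℂ)
      = ∑ a ∈ Finset.range M, ∑ b ∈ Finset.range M,
        (fourier ((a : ℤ) - b) p.1 : ℂ) * fourier (-((a : ℤ) - b)) p.2 := by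
    intro p
    push_cast
    rw [← Complex.mul_conj', map_sum, Finset.sum_mul_sum]
    refine Finset.sum_congr rfl fun a _ => Finset.sum_congr rfl fun b _ => ?_
    rw [← fourier_neg, ← fourier_add]
    simp only [fourier_apply]
    rw [← Circle.coe_mul, ← AddCircle.toCircle_add]
    congr 2
    rw [smul_sub, neg_smul, sub_eq_add_neg, sub_eq_add_neg]
  have hI : ∀ a b : ℕ, Integrable (fun p : AddCircle (1:ℝ) × AddCircle (1:ℝ) =>
      (fourier ((a : ℤ) - b) p.1 : ℂ) * fourier (-((a : ℤ) - b)) p.2) (μ.prod μ) := fun a b =>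
    (fourier_integrable μ _).mul_prod (fourier_integrable μ _)
  have hc : Integrable (fun p : AddCircle (1:ℝ) × AddCircle (1:ℝ) =>
      ((‖∑ a ∈ Finset.range M, (fourier (a : ℤ) (p.1 - p.2) : ℂ)‖ ^ 2 : ℝ) : ℂ)) (μ.prod μ) := by
    simp only [key]
    exact integrable_finsetSum _ fun a _ => integrable_finsetSum _ fun b _ => hI a b
  refine ⟨?_, ?_⟩
  · exact hc.re
  · apply Complex.ofReal_injective
    rw [← integral_complex_ofReal]
    simp only [key]
    rw [integral_finsetSum _ fun a _ => integrable_finsetSum _ fun b _ => hI a b]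
    push_cast
    refine Finset.sum_congr rfl fun a _ => ?_
    rw [integral_finsetSum _ fun b _ => hI a b]
    refine Finset.sum_congr rfl fun b _ => ?_
    rw [integral_prod_mul (fun x => (fourier ((a : ℤ) - b) x : ℂ))
      (fun y => (fourier (-((a : ℤ) - b)) y : ℂ))]
    rw [← Complex.mul_conj', ← muHat_neg, mul_comm]
    unfold muHat1
    rw [neg_neg]

lemma energy_lower (μ : Measure (AddCircle (1 : ℝ))) [IsProbabilityMeasure μ] (M : ℕ)
    (hM : 0 < M) (A : Finset ℕ) (I : ℕ → Set (AddCircle (1 : ℝ)))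
    (hI : ∀ a, MeasurableSet (I a))
    (hd : ∀ a, ∀ x ∈ I a, ∀ y ∈ I a, dist x y ≤ 1 / (6 * M))
    (hE : μ (⋃ a ∈ A, I a)ᶜ = 0) :
    (M : ℝ) ≤ 4 * A.card * (1 + 2 * ∑ n ∈ Finset.range (M - 1), ‖muHat1 μ ((n : ℤ) + 1)‖ ^ 2) := by
  classical
  set I' : ℕ → Set (AddCircle (1 : ℝ)) := fun a => if a ∈ A then I a else ∅ with hI'
  have hI'm : ∀ a, MeasurableSet (I' a) := fun a => by
    simp only [hI']; split_ifs
    · exact hI a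
    · exact MeasurableSet.empty
  set D := disjointed I' with hD
  have hDm : ∀ a, MeasurableSet (D a) := fun a => MeasurableSet.disjointed hI'm a
  have hDs : ∀ a, D a ⊆ I' a := fun a => disjointed_le I' a
  have hDd : Pairwise (Function.onFun Disjoint D) := disjoint_disjointed I'
  have hU : (⋃ a ∈ A, D a) = ⋃ a ∈ A, I a := by
    have h1 : (⋃ a, D a) = ⋃ a, I' a := iUnion_disjointed
    have h2 : (⋃ a, I' a) = ⋃ a ∈ A, I a := by
      ext z; simp only [hI', mem_iUnion]
      constructor
      · rintro ⟨a, ha⟩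
        split_ifs at ha with h
        · exact ⟨a, h, ha⟩
        · exact absurd ha (notMem_empty _)
      · rintro ⟨a, h, ha⟩
        exact ⟨a, by rw [if_pos h]; exact ha⟩
    rw [← h2, ← h1]
    ext z; simp only [mem_iUnion]
    constructor
    · rintro ⟨a, _, ha⟩; exact ⟨a, ha⟩
    · rintro ⟨a, ha⟩
      refine ⟨a, ?_, ha⟩
      by_contra hn
      have := hDs a ha
      simp [hI', hn] at this
  have hsum : ∑ a ∈ A, μ.real (D a) = 1 := by
    rw [← measureReal_biUnion_finset (fun a _ b _ hab => hDd hab) (fun a _ => hDm a), hU]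
    have hm : MeasurableSet (⋃ a ∈ A, I a) := A.measurableSet_biUnion fun a _ => hI a
    have := (prob_compl_eq_zero_iff hm).1 hE
    simp [Measure.real, this]
  have hCS : (1:ℝ) ≤ A.card * ∑ a ∈ A, μ.real (D a) ^ 2 := by
    have := sq_sum_le_card_mul_sum_sq (s := A) (f := fun a => μ.real (D a))
    rwa [hsum, one_pow] at this
  obtain ⟨hGi, hG⟩ := kernel_integral μ M
  have hMr : (0:ℝ) < M := by exact_mod_cast hM
  have hindi : ∀ a, Integrable (fun p : AddCircle (1:ℝ) × AddCircle (1:ℝ) =>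
      (D a).indicator (fun _ => (1:ℝ)) p.1 * (D a).indicator (fun _ => (1:ℝ)) p.2)
      (μ.prod μ) := fun a =>
    ((integrable_const (1:ℝ)).indicator (hDm a)).mul_prod
      ((integrable_const (1:ℝ)).indicator (hDm a))
  have h_integral : ∫ p : AddCircle (1:ℝ) × AddCircle (1:ℝ), (M:ℝ)^2/4 * ∑ a ∈ A,
      (D a).indicator (fun _ => (1:ℝ)) p.1 * (D a).indicator (fun _ => (1:ℝ)) p.2 ∂(μ.prod μ)
      = (M:ℝ)^2/4 * ∑ a ∈ A, μ.real (D a) ^ 2 := by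
    rw [integral_const_mul, integral_finsetSum _ fun a _ => hindi a]
    congr 1
    refine Finset.sum_congr rfl fun a _ => ?_
    rw [integral_prod_mul ((D a).indicator (fun _ => (1:ℝ))) ((D a).indicator (fun _ => (1:ℝ)))]
    rw [integral_indicator_const _ (hDm a)]
    simp [sq]
  have hle : (M:ℝ)^2/4 * ∑ a ∈ A, μ.real (D a) ^ 2
      ≤ ∑ a ∈ Finset.range M, ∑ b ∈ Finset.range M, ‖muHat1 μ ((a : ℤ) - b)‖ ^ 2 := by
    rw [← hG, ← h_integral]
    refine integral_mono ((integrable_finsetSum _ fun a _ => hindi a).const_mul _) hGi ?_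
    intro p
    simp only
    by_cases hp : ∃ a ∈ A, p.1 ∈ D a ∧ p.2 ∈ D a
    · obtain ⟨a, ha, h1, h2⟩ := hp
      have : ∑ a ∈ A, (D a).indicator (fun _ => (1:ℝ)) p.1 * (D a).indicator (fun _ => (1:ℝ)) p.2
          = 1 := by
        rw [Finset.sum_eq_single a]
        · simp [h1, h2]
        · intro b _ hb
          have : p.1 ∉ D b := fun h => (Set.disjoint_left.1 (hDd hb) h h1)
          simp [this]
        · intro h; exact absurd ha h
      rw [this, mul_one]
      have hh := norm_fourier_sum_ge M hM (p.1 - p.2) (by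
        rw [← dist_eq_norm]
        have q1 := hDs a h1
        have q2 := hDs a h2
        simp only [hI', if_pos ha] at q1 q2
        exact hd a _ q1 _ q2)
      calc (M:ℝ)^2/4 = (M/2)^2 := by ring
        _ ≤ _ := by gcongr
    · have : ∑ a ∈ A, (D a).indicator (fun _ => (1:ℝ)) p.1 * (D a).indicator (fun _ => (1:ℝ)) p.2
          = 0 := by
        refine Finset.sum_eq_zero fun a ha => ?_
        by_cases h1 : p.1 ∈ D a
        · have : p.2 ∉ D a := fun h2 => hp ⟨a, ha, h1, h2⟩
          simp [this]
        · simp [h1]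
      rw [this, mul_zero]; positivity
  have hup : ∑ a ∈ Finset.range M, ∑ b ∈ Finset.range M, ‖muHat1 μ ((a : ℤ) - b)‖ ^ 2
      ≤ M * (1 + 2 * ∑ n ∈ Finset.range (M - 1), ‖muHat1 μ ((n : ℤ) + 1)‖ ^ 2) := by
    have : ∀ a ∈ Finset.range M, ∑ b ∈ Finset.range M, ‖muHat1 μ ((a : ℤ) - b)‖ ^ 2
        ≤ (1 + 2 * ∑ n ∈ Finset.range (M - 1), ‖muHat1 μ ((n : ℤ) + 1)‖ ^ 2) := by
      intro a ha
      have := sum_natAbs_le (fun n => ‖muHat1 μ (n : ℤ)‖ ^ 2) (fun n => by positivity) M a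
        (Finset.mem_range.1 ha)
      have h0 : ‖muHat1 μ ((0:ℕ) : ℤ)‖ ^ 2 = 1 := by simp [muHat1]
      simp only [h0, ← norm_muHat_natAbs] at this
      push_cast at this
      exact this
    calc _ ≤ ∑ a ∈ Finset.range M, _ := Finset.sum_le_sum this
      _ = _ := by rw [Finset.sum_const, Finset.card_range, nsmul_eq_mul]
  have hcard : (0:ℝ) ≤ A.card := by positivity
  set R := (1 + 2 * ∑ n ∈ Finset.range (M - 1), ‖muHat1 μ ((n : ℤ) + 1)‖ ^ 2)
  set Q := ∑ a ∈ A, μ.real (D a) ^ 2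
  have h5 : (M:ℝ)^2/4 * Q ≤ M * R := hle.trans hup
  have h6 : (M:ℝ) * Q ≤ 4 * R := by
    have : (M:ℝ) * (M * Q) ≤ M * (4 * R) := by nlinarith
    exact le_of_mul_le_mul_left this hMr
  calc (M:ℝ) ≤ M * (A.card * Q) := le_mul_of_one_le_right hMr.le hCS
    _ = A.card * (M * Q) := by ring
    _ ≤ A.card * (4 * R) := by gcongr
    _ = _ := by ring

/-- An arc of the circle. -/
def arc (c δ : ℝ) : Set (AddCircle (1 : ℝ)) :=
  (fun t : ℝ => (t : AddCircle (1 : ℝ))) '' Icc c (c + δ)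

lemma arc_measurable (c δ : ℝ) : MeasurableSet (arc c δ) :=
  (isCompact_Icc.image (AddCircle.continuous_mk' 1)).isClosed.measurableSet

lemma norm_coe_le_abs (s : ℝ) : ‖(s : AddCircle (1 : ℝ))‖ ≤ |s| := by
  have := AddCircle.norm_eq (p := 1) (x := s)
  simp only [inv_one, one_mul, mul_one] at this
  rw [this]
  simpa using round_le s 0

lemma arc_dist (c δ : ℝ) : ∀ x ∈ arc c δ, ∀ y ∈ arc c δ, dist x y ≤ δ := by
  rintro _ ⟨s, hs, rfl⟩ _ ⟨t, ht, rfl⟩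
  simp only
  rw [dist_eq_norm, ← AddCircle.coe_sub]
  refine (norm_coe_le_abs _).trans ?_
  rw [abs_le]
  constructor <;> linarith [hs.1, hs.2, ht.1, ht.2]

lemma arc_ediam (c δ : ℝ) : Metric.ediam (arc c δ) ≤ ENNReal.ofReal δ := by
  refine Metric.ediam_le fun x hx y hy => ?_
  rw [edist_dist]
  exact ENNReal.ofReal_le_ofReal (arc_dist c δ x hx y hy)

lemma vv_tail (x : ℕ → ℕ) (hx : ∀ i, x i ≤ 1) (P q : ℕ) (hPq : P ≤ q)
    (hz : ∀ i, P ≤ i → i < q → x i = 0) :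
    (av x P : ℝ) / 2 ^ P ≤ vv x ∧ vv x ≤ (av x P : ℝ) / 2 ^ P + 1 / 2 ^ q := by
  obtain ⟨Z, rfl⟩ := Nat.exists_eq_add_of_le hPq
  have h := vv_split x hx (P + Z)
  rw [av_add, av_zero (fun i => x (P + i)) Z (fun i hi => hz _ (by omega) (by omega))] at h
  have h1 := vv_nonneg (fun i => x (P + Z + i))
  have h2 := vv_le_one (fun i => x (P + Z + i)) (fun i => hx _)
  have e : vv x = (av x P : ℝ) / 2 ^ P + vv (fun i => x (P + Z + i)) / 2 ^ (P + Z) := by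
    rw [h, pow_add]; push_cast; field_simp; ring
  rw [e]
  constructor
  · have : 0 ≤ vv (fun i => x (P + Z + i)) / 2 ^ (P + Z) := by positivity
    linarith
  · gcongr

lemma kfold_cover (lam : ℝ) (k P q : ℕ) (hPq : P ≤ q)
    (hz : ∀ i, P ≤ i → i < q → i ∈ Kset lam 1) (A : Finset ℕ)
    (hA : ∀ x : Fin k → ℕ → ℕ, (∀ l i, x l i ≤ 1) → (∀ l, ∀ i ∈ Kset lam 1, x l i = 0) →
        ∑ l, av (x l) P ∈ A) :
    kFold1 k (Sset lam 1) ⊆ ⋃ a ∈ A, arc ((a : ℝ) / 2 ^ P) (k / 2 ^ q) := by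
  rintro y ⟨g, hg, rfl⟩
  choose x hx1 hx2 hx3 using hg
  refine mem_iUnion₂.2 ⟨_, hA x hx1 hx2, ∑ l, vv (x l), ⟨?_, ?_⟩, ?_⟩
  · push_cast
    rw [Finset.sum_div]
    exact Finset.sum_le_sum fun l _ => (vv_tail (x l) (hx1 l) P q hPq
      fun i h h' => hx2 l i (hz i h h')).1
  · push_cast
    rw [Finset.sum_div]
    have : (k : ℝ) / 2 ^ q = ∑ l : Fin k, (1:ℝ) / 2 ^ q := by simp [div_eq_mul_inv]
    rw [this, ← Finset.sum_add_distrib]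
    exact Finset.sum_le_sum fun l _ => (vv_tail (x l) (hx1 l) P q hPq
      fun i h h' => hx2 l i (hz i h h')).2
  · simp only
    rw [Finset.sum_congr rfl fun l _ => hx3 l]
    exact map_sum (QuotientAddGroup.mk' (AddSubgroup.zmultiples (1:ℝ))) _ _

lemma exists_cover (lam : ℝ) (h0 : 0 ≤ lam) (h1 : lam < 1) (k : ℕ) (hk : 0 < k) :
    ∃ C : ℝ, 0 < C ∧ ∃ J : ℕ, 0 < J ∧ ∀ j ≥ J, ∃ A : Finset ℕ, ∃ q : ℕ,
      (A.card : ℝ) ≤ C * (2:ℝ) ^ ((1 - lam) * 2 ^ j) ∧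
      (2:ℝ) ^ j * (1 + lam + 1 / (j : ℝ)) ≤ q ∧ j ≤ q ∧
      kFold1 k (Sset lam 1) ⊆ ⋃ a ∈ A, arc ((a : ℝ) / 2 ^ (2 ^ j)) (k / 2 ^ q) := by
  obtain ⟨C, hC, J, hJ⟩ := exists_sum_set lam h0 h1 k hk
  refine ⟨C, hC, J + 1, by omega, fun j hj => ?_⟩
  obtain ⟨A, hA, hA'⟩ := hJ j (by omega)
  have hj0 : 0 < j := by omega
  have hjr : (0:ℝ) < j := by exact_mod_cast hj0
  have hq2 : (2:ℝ) ^ j * (1 + lam + 1 / (j : ℝ))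
      ≤ (⌊(2:ℝ) ^ j * (1 + lam + 1 / (j : ℝ))⌋₊ + 1 : ℕ) := by
    have := Nat.lt_floor_add_one ((2:ℝ) ^ j * (1 + lam + 1 / (j : ℝ)))
    push_cast; exact this.le
  have hjinv : 0 < 1 / (j:ℝ) := by positivity
  have hq3 : 2 ^ j ≤ ⌊(2:ℝ) ^ j * (1 + lam + 1 / (j : ℝ))⌋₊ + 1 := by
    have h2j : (0:ℝ) < 2 ^ j := by positivity
    have : ((2 ^ j : ℕ) : ℝ) ≤ (⌊(2:ℝ) ^ j * (1 + lam + 1 / (j : ℝ))⌋₊ + 1 : ℕ) := by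
      refine le_trans ?_ hq2
      push_cast
      nlinarith
    exact_mod_cast this
  refine ⟨A, ⌊(2:ℝ) ^ j * (1 + lam + 1 / (j : ℝ))⌋₊ + 1, hA, hq2,
    (Nat.lt_two_pow_self.le).trans hq3, ?_⟩
  exact kfold_cover lam k _ _ hq3 (fun i h h' => mem_K lam j hj0 i h h') A hA'

lemma K_one (i : ℕ) (hi : 2 ≤ i) : i ∈ Kset 1 1 := by
  have hj : 0 < Nat.log 2 i := Nat.log_pos (by norm_num) hi
  refine ⟨Nat.log 2 i, hj, ?_, ?_⟩
  · exact_mod_cast Nat.pow_log_le_self 2 (by omega)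
  · have h := Nat.lt_pow_succ_log_self (b := 2) (by norm_num) i
    have h' : (i:ℝ) ≤ 2 ^ (Nat.log 2 i + 1) := by exact_mod_cast h.le
    rw [pow_succ] at h'
    have hjr : (0:ℝ) < Nat.log 2 i := by exact_mod_cast hj
    have : 0 ≤ (2:ℝ) ^ (Nat.log 2 i) * (1 / (Nat.log 2 i : ℝ)) := by positivity
    push_cast
    nlinarith

lemma cover_one (k q : ℕ) (hq : 2 ≤ q) :
    kFold1 k (Sset 1 1) ⊆ ⋃ a ∈ Finset.range (4 * k + 1), arc ((a : ℝ) / 2 ^ 2) (k / 2 ^ q) := by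
  refine kfold_cover 1 k 2 q hq (fun i h _ => K_one i h) _ ?_
  intro x hx _
  rw [Finset.mem_range, Nat.lt_succ_iff]
  calc ∑ l, av (x l) 2 ≤ ∑ l : Fin k, 2 ^ 2 :=
        Finset.sum_le_sum fun l _ => (av_lt _ (hx l) _).le
    _ = _ := by simp; ring

lemma kfold_one_finite (k : ℕ) : (kFold1 k (Sset 1 1)).Finite := by
  have hS : (Sset 1 1).Finite := by
    refine ((Finset.range 4).finite_toSet.image
      (fun a : ℕ => (((a : ℝ) / 2 ^ 2 : ℝ) : AddCircle (1:ℝ)))).subset ?_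
    rintro y ⟨x, hx1, hx2, rfl⟩
    refine ⟨av x 2, by simpa using av_lt x hx1 2, ?_⟩
    simp only
    congr 1
    have h := vv_split x hx1 2
    have hz : vv (fun i => x (2 + i)) = 0 := by
      have : ∀ i, x (2 + i) = 0 := fun i => hx2 _ (K_one _ (by omega))
      simp [vv, this]
    rw [hz, add_zero] at h
    exact h.symm
  refine ((Set.Finite.pi' (fun _ : Fin k => hS)).image (fun g => ∑ i, g i)).subset ?_
  rintro y ⟨g, hg, rfl⟩
  exact ⟨g, hg, rfl⟩

lemma partial_bound (α : ℝ) (hα : α ≤ 1) (μ : Measure (AddCircle (1 : ℝ)))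
    (h : HasFiniteEnergy1 α μ) : ∃ B : ℝ, 0 ≤ B ∧ ∀ M : ℕ,
    ∑ n ∈ Finset.range (M - 1), ‖muHat1 μ ((n : ℤ) + 1)‖ ^ 2 ≤ B * (M : ℝ) ^ (1 - α) := by
  refine ⟨∑' n : ℕ, ‖muHat1 μ (n + 1)‖ ^ 2 /
    (1 + ((n : ℝ) + 1)) ^ (1 - α), tsum_nonneg (fun n => by positivity), fun M => ?_⟩
  have h1 := h.sum_le_tsum (Finset.range (M - 1)) (fun n _ => by positivity)
  refine le_trans ?_ (mul_le_mul_of_nonneg_right h1 (by positivity))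
  rw [Finset.sum_mul]
  refine Finset.sum_le_sum fun n hn => ?_
  rw [Finset.mem_range] at hn
  have hp : (0:ℝ) < (1 + ((n : ℝ) + 1)) ^ (1 - α) := by positivity
  have hle : (1 + ((n : ℝ) + 1)) ^ (1 - α) ≤ (M : ℝ) ^ (1 - α) := by
    refine Real.rpow_le_rpow (by positivity) ?_ (by linarith)
    have : 1 + (n + 1) ≤ M := by omega
    exact_mod_cast this
  rw [div_mul_eq_mul_div, le_div_iff₀ hp]
  gcongr

lemma alpha_mul (lam : ℝ) (h0 : 0 ≤ lam) :
    (1 - lam) / (1 + lam) * (1 + lam) = 1 - lam := by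
  have : 1 + lam ≠ 0 := by positivity
  field_simp

lemma capacity_lt (lam : ℝ) (h0 : 0 ≤ lam) (h1 : lam < 1) (k : ℕ) (hk : 0 < k) :
    CapacityZero1 ((1 - lam) / (1 + lam)) (kFold1 k (Sset lam 1)) := by
  rintro μ hμ ⟨K, hKE, -, hK⟩ hfin
  have hα0 : 0 < (1 - lam) / (1 + lam) := div_pos (by linarith) (by linarith)
  have hα1 : (1 - lam) / (1 + lam) ≤ 1 := by rw [div_le_one (by linarith)]; linarith
  have hαm := alpha_mul lam h0
  set α := (1 - lam) / (1 + lam)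
  obtain ⟨B, hB, hBM⟩ := partial_bound α hα1 μ hfin
  obtain ⟨C, hC, J, hJ0, hJ⟩ := exists_cover lam h0 h1 k hk
  obtain ⟨n, hn⟩ := exists_nat_gt (4 * (1 + 2 * B) * C)
  obtain ⟨j, hj1, hj2, hj3⟩ := ((tendsto_pow_div.const_mul_atTop hα0).eventually_ge_atTop
    (α * (k + 3) + n) |>.and ((eventually_ge_atTop J).and (eventually_ge_atTop (k + 3)))).exists
  obtain ⟨A, q, hA, hq, hjq, hcov⟩ := hJ j hj2
  obtain ⟨m, hm⟩ : ∃ m, q = m + (k + 3) := ⟨q - (k + 3), by omega⟩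
  have hM : 0 < 2 ^ m := by positivity
  have key := energy_lower μ (2 ^ m) hM A (fun a => arc ((a : ℝ) / 2 ^ (2 ^ j)) (k / 2 ^ q))
    (fun a => arc_measurable _ _) (fun a x hx y hy => by
      refine (arc_dist _ _ x hx y hy).trans ?_
      rw [hm, pow_add, pow_add]
      push_cast
      rw [div_le_div_iff₀ (by positivity) (by positivity)]
      have : (k : ℝ) ≤ 2 ^ k := by exact_mod_cast Nat.lt_two_pow_self.le
      have h2m : (0:ℝ) < 2 ^ m := by positivity
      nlinarith [mul_le_mul_of_nonneg_right this h2m.le])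
    (measure_mono_null (compl_subset_compl.2 (hKE.trans hcov)) hK)
  have hB2 := hBM (2 ^ m)
  push_cast at key hB2
  set R := ((2:ℝ) ^ m) ^ (1 - α)
  have hM1 : (1:ℝ) ≤ 2 ^ m := one_le_pow₀ (by norm_num)
  have hR1 : 1 ≤ R := Real.one_le_rpow hM1 (by linarith)
  have hsplit : (2:ℝ) ^ m = ((2:ℝ) ^ m) ^ α * R := by
    rw [← Real.rpow_add (by positivity)]; simp
  have key2 : ((2:ℝ) ^ m) ^ α ≤ 4 * A.card * (1 + 2 * B) := by
    refine le_of_mul_le_mul_right (a := R) ?_ (by linarith)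
    rw [← hsplit]
    refine key.trans ?_
    rw [mul_assoc (4 * (A.card : ℝ))]
    refine mul_le_mul_of_nonneg_left ?_ (mul_nonneg (by norm_num) (Nat.cast_nonneg _))
    nlinarith
  have key3 : ((2:ℝ) ^ m) ^ α ≤ 4 * (1 + 2 * B) * C * (2:ℝ) ^ ((1 - lam) * 2 ^ j) := by
    refine key2.trans ?_
    calc 4 * (A.card : ℝ) * (1 + 2 * B)
        ≤ 4 * (C * (2:ℝ) ^ ((1 - lam) * 2 ^ j)) * (1 + 2 * B) := by gcongr
      _ = _ := by ring
  have key4 : (2:ℝ) ^ ((n:ℝ) + (1 - lam) * 2 ^ j) ≤ ((2:ℝ) ^ m) ^ α := by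
    rw [← Real.rpow_natCast 2 m, ← Real.rpow_mul (by norm_num)]
    refine Real.rpow_le_rpow_of_exponent_le (by norm_num) ?_
    have hmq : (q : ℝ) = m + (k + 3) := by exact_mod_cast hm
    have e := mul_le_mul_of_nonneg_left hq hα0.le
    have e2 : α * ((2:ℝ) ^ j * (1 + lam + 1 / (j:ℝ)))
      = (α * (1 + lam)) * 2 ^ j + α * ((2:ℝ) ^ j / (j:ℝ)) := by ring
    rw [e2, hαm, hmq] at e
    nlinarith
  have key5 := key4.trans key3
  rw [Real.rpow_add (by norm_num)] at key5
  have key6 := le_of_mul_le_mul_right key5 (by positivity)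
  have : (n:ℝ) ≤ (2:ℝ) ^ (n:ℝ) := by
    rw [Real.rpow_natCast]; exact_mod_cast Nat.lt_two_pow_self.le
  linarith

lemma capacity_one (k : ℕ) : CapacityZero1 0 (kFold1 k (Sset 1 1)) := by
  rintro μ hμ ⟨K, hKE, -, hK⟩ hfin
  set f : ℕ → ℝ := fun n => ‖muHat1 μ (n + 1)‖ ^ 2 / (1 + ((n : ℝ) + 1)) ^ ((1:ℝ) - 0) with hf
  have hfn : ∀ n, 0 ≤ f n := fun n => by simp only [hf]; positivity
  have hfe : ∀ n : ℕ, ‖muHat1 μ ((n:ℤ) + 1)‖ ^ 2 = f n * (n + 2) := fun n => by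
    simp only [hf, sub_zero, Real.rpow_one]
    have : (1 + ((n:ℝ) + 1)) ≠ 0 := by positivity
    field_simp; ring
  have hs : Summable f := hfin
  set N : ℝ := 4 * k + 1 with hN
  have hNpos : 0 < N := by positivity
  have hlow : ∀ M : ℕ, 0 < M → (M:ℝ) ≤ 4 * N * (1 + 2 * ∑ n ∈ Finset.range (M - 1),
      ‖muHat1 μ ((n : ℤ) + 1)‖ ^ 2) := by
    intro M hM
    have key := energy_lower μ M hM (Finset.range (4 * k + 1))
      (fun a => arc ((a : ℝ) / 2 ^ 2) (k / 2 ^ (6 * k * M + 2)))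
      (fun a => arc_measurable _ _) (fun a x hx y hy => by
        refine (arc_dist _ _ x hx y hy).trans ?_
        have hMr : (0:ℝ) < M := by exact_mod_cast hM
        rw [div_le_div_iff₀ (by positivity) (by positivity)]
        have : ((6 * k * M + 2 : ℕ) : ℝ) ≤ 2 ^ (6 * k * M + 2) := by
          exact_mod_cast Nat.lt_two_pow_self.le
        push_cast at this
        linarith)
      (measure_mono_null (compl_subset_compl.2 (hKE.trans (cover_one k _ (by omega)))) hK)
    rw [Finset.card_range] at key
    push_cast at key
    exact key
  have hε : 0 < 1 / (16 * N) := by positivity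
  obtain ⟨m0, hm0⟩ := (hs.hasSum.tendsto_sum_nat.eventually_const_lt
    (show ∑' n, f n - 1 / (16 * N) < ∑' n, f n by linarith)).exists
  have hup : ∀ M : ℕ, m0 ≤ M → ∑ n ∈ Finset.range M, ‖muHat1 μ ((n : ℤ) + 1)‖ ^ 2 ≤
      ∑ n ∈ Finset.range m0, ‖muHat1 μ ((n : ℤ) + 1)‖ ^ 2 + 1 / (16 * N) * (M + 1) := by
    intro M hM
    rw [← Finset.sum_range_add_sum_Ico _ hM]
    have h1 : ∑ n ∈ Finset.Ico m0 M, f n ≤ 1 / (16 * N) := by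
      have a := Finset.sum_range_add_sum_Ico f hM
      have b := hs.sum_le_tsum (Finset.range M) (fun n _ => hfn n)
      linarith
    have h2 : ∑ n ∈ Finset.Ico m0 M, ‖muHat1 μ ((n : ℤ) + 1)‖ ^ 2
        ≤ (∑ n ∈ Finset.Ico m0 M, f n) * (M + 1) := by
      rw [Finset.sum_mul]
      refine Finset.sum_le_sum fun n hn => ?_
      rw [hfe]
      refine mul_le_mul_of_nonneg_left ?_ (hfn n)
      have : n + 2 ≤ M + 1 := by have := (Finset.mem_Ico.1 hn).2; omega
      exact_mod_cast this
    have h3 : (∑ n ∈ Finset.Ico m0 M, f n) * ((M:ℝ) + 1) ≤ 1 / (16 * N) * (M + 1) := by gcongr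
    linarith
  set A0 := ∑ n ∈ Finset.range m0, ‖muHat1 μ ((n : ℤ) + 1)‖ ^ 2
  obtain ⟨M, hM⟩ := exists_nat_gt (8 * N * (1 + 2 * A0))
  have hM2 := hlow (M + m0 + 1) (by omega)
  have hM3 := hup (M + m0) (by omega)
  simp only [Nat.add_sub_cancel] at hM2
  have hM4 := mul_le_mul_of_nonneg_left hM3 (by positivity : 0 ≤ 8 * N)
  have e : 8 * N * (1 / (16 * N) * ((M + m0 : ℕ) + 1)) = (((M + m0 : ℕ):ℝ) + 1) / 2 := by
    field_simp; ring
  have hm0 : (0:ℝ) ≤ m0 := by positivity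
  rw [mul_add (8 * N) A0, e] at hM4
  push_cast at hM2 hM4
  nlinarith

lemma dim_upper (lam : ℝ) (h0 : 0 ≤ lam) (h1 : lam < 1) (k : ℕ) (hk : 0 < k) :
    dimH (kFold1 k (Sset lam 1)) ≤ ENNReal.ofReal ((1 - lam) / (1 + lam)) := by
  have hα0 : 0 < (1 - lam) / (1 + lam) := div_pos (by linarith) (by linarith)
  have hαm := alpha_mul lam h0
  set α := (1 - lam) / (1 + lam)
  obtain ⟨C, hC, J, hJ0, hJ⟩ := exists_cover lam h0 h1 k hk
  choose A q hA hq hjq hcov using fun n : ℕ => hJ (J + n) (by omega)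
  have hz : μH[α] (kFold1 k (Sset lam 1)) ≤ 0 := by
    have hr : Tendsto (fun n : ℕ => ENNReal.ofReal ((k:ℝ) / 2 ^ q n)) atTop (𝓝 0) := by
      have : Tendsto (fun n : ℕ => (k:ℝ) / 2 ^ q n) atTop (𝓝 0) := by
        have t : Tendsto (fun n : ℕ => (k:ℝ) * (1/2) ^ n) atTop (𝓝 0) := by
          simpa using (tendsto_pow_atTop_nhds_zero_of_lt_one (r := (1/2:ℝ)) (by norm_num)
            (by norm_num)).const_mul (k:ℝ)
        refine squeeze_zero (fun n => by positivity) (fun n => ?_) t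
        rw [one_div, inv_pow, ← div_eq_mul_inv]
        have : n ≤ q n := by have := hjq n; omega
        gcongr
        norm_num
      simpa using ENNReal.tendsto_ofReal this
    have hle := Measure.hausdorffMeasure_le_liminf_sum α (kFold1 k (Sset lam 1)) (l := atTop)
      (fun n : ℕ => ENNReal.ofReal ((k:ℝ) / 2 ^ q n)) hr
      (fun n (a : A n) => arc ((a : ℝ) / 2 ^ (2 ^ (J + n))) (k / 2 ^ q n))
      (Eventually.of_forall fun n a => arc_ediam _ _)
      (Eventually.of_forall fun n => by
        refine (hcov n).trans ?_
        intro z hz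
        obtain ⟨a, ha, hz⟩ := mem_iUnion₂.1 hz
        exact mem_iUnion.2 ⟨⟨a, ha⟩, hz⟩)
    refine hle.trans (le_of_eq ?_)
    refine Tendsto.liminf_eq ?_
    have t1 : Tendsto (fun n : ℕ => ENNReal.ofReal (C * (k:ℝ) ^ α *
        (1/2 : ℝ) ^ (α * ((2:ℝ) ^ (J + n) / ((J + n : ℕ) : ℝ))))) atTop (𝓝 0) := by
      have s1 : Tendsto (fun n : ℕ => α * ((2:ℝ) ^ (J + n) / ((J + n : ℕ) : ℝ))) atTop atTop := by
        have := tendsto_pow_div.const_mul_atTop hα0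
        have s2 : Tendsto (fun n : ℕ => J + n) atTop atTop :=
          tendsto_atTop_mono (fun n => Nat.le_add_left n J) tendsto_id
        exact this.comp s2
      have s3 := (tendsto_rpow_atTop_of_base_lt_one (1/2:ℝ) (by norm_num) (by norm_num)).comp s1
      have s4 := ENNReal.tendsto_ofReal (s3.const_mul (C * (k:ℝ) ^ α))
      simpa using s4
    refine tendsto_of_tendsto_of_tendsto_of_le_of_le tendsto_const_nhds t1
      (fun n => zero_le) (fun n => ?_)
    calc ∑ a : A n, Metric.ediam (arc ((a : ℝ) / 2 ^ (2 ^ (J + n))) (k / 2 ^ q n)) ^ α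
        ≤ ∑ a : A n, (ENNReal.ofReal ((k:ℝ) / 2 ^ q n)) ^ α := by
          refine Finset.sum_le_sum fun a _ => ?_
          exact ENNReal.rpow_le_rpow (arc_ediam _ _) hα0.le
      _ = ENNReal.ofReal ((A n).card * ((k:ℝ) / 2 ^ q n) ^ α) := by
          rw [Finset.sum_const, Finset.card_univ, Fintype.card_coe, nsmul_eq_mul,
            ENNReal.ofReal_mul (by positivity), ENNReal.ofReal_natCast,
            ENNReal.ofReal_rpow_of_nonneg (by positivity) hα0.le]
      _ ≤ _ := by
          refine ENNReal.ofReal_le_ofReal ?_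
          have hqn := mul_le_mul_of_nonneg_left (hq n) hα0.le
          have e2 : α * ((2:ℝ) ^ (J + n) * (1 + lam + 1 / ((J + n : ℕ):ℝ)))
            = (α * (1 + lam)) * 2 ^ (J + n) + α * ((2:ℝ) ^ (J + n) / ((J + n : ℕ):ℝ)) := by ring
          rw [e2, hαm] at hqn
          rw [Real.div_rpow (by positivity) (by positivity), ← Real.rpow_natCast 2 (q n),
            ← Real.rpow_mul (by norm_num), one_div, Real.inv_rpow (by norm_num),
            ← Real.rpow_neg (by norm_num), div_eq_mul_inv, ← Real.rpow_neg (by norm_num)]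
          calc ((A n).card : ℝ) * ((k:ℝ) ^ α * 2 ^ (-((q n : ℝ) * α)))
              ≤ (C * (2:ℝ) ^ ((1 - lam) * 2 ^ (J + n))) * ((k:ℝ) ^ α * 2 ^ (-((q n : ℝ) * α))) := by
                gcongr; exact hA n
            _ = (C * (k:ℝ) ^ α) * ((2:ℝ) ^ ((1 - lam) * 2 ^ (J + n)) * 2 ^ (-((q n : ℝ) * α))) := by
                ring
            _ ≤ _ := by
                rw [← Real.rpow_add (by norm_num)]
                refine mul_le_mul_of_nonneg_left ?_ (by positivity)
                refine Real.rpow_le_rpow_of_exponent_le (by norm_num) ?_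
                linarith
  have : μH[((α.toNNReal : NNReal) : ℝ)] (kFold1 k (Sset lam 1)) ≠ ∞ := by
    rw [Real.coe_toNNReal _ hα0.le, le_antisymm hz zero_le]
    simp
  exact dimH_le_of_hausdorffMeasure_ne_top this

open Classical in
/-- Number of free digits among the first `n`. -/
def freeCount (lam : ℝ) (n : ℕ) : ℕ := ((Finset.range n).filter (fun i => i ∉ Kset lam 1)).card

open Classical in
lemma freeCount_lower (lam θ : ℝ) (h0 : 0 ≤ lam) (hθ : lam < θ) (hθ1 : θ < 1) :
    ∃ c : ℝ, ∀ n : ℕ, (1 - θ) / (1 + θ) * n - c ≤ freeCount lam n := by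
  have e1 : ∀ᶠ j : ℕ in atTop, 1 / (j : ℝ) < (θ - lam) / 2 :=
    tendsto_one_div_atTop_nhds_zero_nat.eventually_lt_const (by linarith)
  have e2 : ∀ᶠ j : ℕ in atTop, 2 / (θ - lam) ≤ (2:ℝ) ^ j :=
    (tendsto_pow_atTop_atTop_of_one_lt (by norm_num)).eventually_ge_atTop _
  obtain ⟨J, hJ⟩ := eventually_atTop.1 (e1.and e2)
  have hpos : 0 < θ - lam := by linarith
  set Kc : ℕ → ℕ := fun n => ((Finset.range n).filter (fun i => i ∈ Kset lam 1)).card with hKc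
  have hstruct : ∀ j ≥ J + 2, ∀ m ∈ Kset lam 1, 2 ^ j ≤ m → m < 2 ^ (j + 1) →
      (m : ℝ) ≤ 2 ^ j * (1 + lam + 1 / (j : ℝ)) := by
    rintro j hj m ⟨j', hj'0, hm1, hm2⟩ hm3 hm4
    have hj'j : j' < j + 1 := by
      have : 2 ^ j' < 2 ^ (j + 1) := lt_of_le_of_lt (by exact_mod_cast hm1) hm4
      exact (Nat.pow_lt_pow_iff_right (by norm_num)).1 this
    have hm2' : (m:ℝ) ≤ 2 ^ j' * (1 + lam + 1 / (j' : ℝ)) := by push_cast at hm2; linarith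
    have hm3' : (2:ℝ) ^ j ≤ m := by exact_mod_cast hm3
    rcases eq_or_ne j' j with rfl | hne
    · exact hm2'
    exfalso
    have h2 : (0:ℝ) < 2 ^ j' := by positivity
    rcases eq_or_ne (j' + 1) j with rfl | hne2
    · have := (hJ j' (by omega)).1
      rw [pow_succ] at hm3'
      nlinarith
    · have hle : (2:ℝ) ^ (j' + 2) ≤ 2 ^ j := pow_le_pow_right₀ (by norm_num) (by omega)
      rw [pow_add] at hle
      have : 1 / (j':ℝ) ≤ 1 := by
        rw [div_le_one (by exact_mod_cast hj'0)]; exact_mod_cast hj'0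
      nlinarith
  have hblock : ∀ j ≥ J + 2, ∀ n, 2 ^ j ≤ n → n ≤ 2 ^ (j + 1) →
      (Kc n : ℝ) ≤ Kc (2 ^ j) + min ((n:ℝ) - 2 ^ j) (θ * 2 ^ j) := by
    intro j hj n hn1 hn2
    have hsplit : Kc n = Kc (2 ^ j)
        + ((Finset.Ico (2 ^ j) n).filter (fun i => i ∈ Kset lam 1)).card := by
      simp only [hKc]
      rw [Finset.card_filter, Finset.card_filter, Finset.card_filter,
        Finset.sum_range_add_sum_Ico _ hn1]
    rw [hsplit]
    push_cast
    refine add_le_add_right (le_min ?_ ?_) _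
    · have h := Finset.card_filter_le (Finset.Ico (2 ^ j) n) (fun i => i ∈ Kset lam 1)
      rw [Nat.card_Ico] at h
      have : (((Finset.Ico (2 ^ j) n).filter (fun i => i ∈ Kset lam 1)).card : ℝ)
          ≤ ((n - 2 ^ j : ℕ) : ℝ) := by exact_mod_cast h
      rw [Nat.cast_sub hn1] at this
      push_cast at this
      exact this
    · have hsub : (Finset.Ico (2 ^ j) n).filter (fun i => i ∈ Kset lam 1)
          ⊆ Finset.Icc (2 ^ j) ⌊(2:ℝ) ^ j * (1 + lam + 1 / (j : ℝ))⌋₊ := by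
        intro i hi
        rw [Finset.mem_filter, Finset.mem_Ico] at hi
        rw [Finset.mem_Icc]
        exact ⟨hi.1.1, Nat.le_floor (hstruct j hj i hi.2 hi.1.1 (by omega))⟩
      have h := Finset.card_le_card hsub
      rw [Nat.card_Icc] at h
      have hjinv : (0:ℝ) ≤ 1 / (j:ℝ) := by positivity
      have h2j : (0:ℝ) < 2 ^ j := by positivity
      have hfl : 2 ^ j ≤ ⌊(2:ℝ) ^ j * (1 + lam + 1 / (j : ℝ))⌋₊ := by
        refine Nat.le_floor ?_
        push_cast
        nlinarith
      have hfl2 : (⌊(2:ℝ) ^ j * (1 + lam + 1 / (j : ℝ))⌋₊ : ℝ)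
          ≤ (2:ℝ) ^ j * (1 + lam + 1 / (j : ℝ)) := Nat.floor_le (by positivity)
      have h' : (((Finset.Ico (2 ^ j) n).filter (fun i => i ∈ Kset lam 1)).card : ℝ) + 2 ^ j
          ≤ ⌊(2:ℝ) ^ j * (1 + lam + 1 / (j : ℝ))⌋₊ + 1 := by
        have : ((Finset.Ico (2 ^ j) n).filter (fun i => i ∈ Kset lam 1)).card + 2 ^ j
          ≤ ⌊(2:ℝ) ^ j * (1 + lam + 1 / (j : ℝ))⌋₊ + 1 := by omega
        exact_mod_cast this
      obtain ⟨q1, q2⟩ := hJ j (by omega)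
      rw [div_le_iff₀ hpos] at q2
      nlinarith
  have hind : ∀ j ≥ J + 2, (Kc (2 ^ j) : ℝ) ≤ θ * 2 ^ j + 2 ^ (J + 2) := by
    intro j hj
    induction j, hj using Nat.le_induction with
    | base =>
      have : Kc (2 ^ (J + 2)) ≤ 2 ^ (J + 2) := by
        have := Finset.card_filter_le (Finset.range (2 ^ (J + 2))) (fun i => i ∈ Kset lam 1)
        rwa [Finset.card_range] at this
      have h : (Kc (2 ^ (J + 2)) : ℝ) ≤ 2 ^ (J + 2) := by exact_mod_cast this
      have : 0 ≤ θ * 2 ^ (J + 2) := by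
        have : 0 ≤ θ := by linarith
        positivity
      linarith
    | succ j hj ih =>
      have h := hblock j hj (2 ^ (j + 1)) (Nat.pow_le_pow_right (by norm_num) (by omega)) le_rfl
      have h2 := min_le_right ((((2 ^ (j + 1) : ℕ)):ℝ) - 2 ^ j) (θ * 2 ^ j)
      rw [pow_succ (2:ℝ) j]
      linarith
  have hFK : ∀ n, (freeCount lam n : ℝ) = n - Kc n := by
    intro n
    have := Finset.card_filter_add_card_filter_not (s := Finset.range n)
      (fun i => i ∈ Kset lam 1)
    rw [Finset.card_range] at this
    have h : ((Kc n + freeCount lam n : ℕ) : ℝ) = n := by exact_mod_cast this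
    push_cast at h
    linarith
  have hθp : 0 < 1 + θ := by linarith
  set r := (1 - θ) / (1 + θ) with hr
  have hrm : r * (1 + θ) = 1 - θ := by rw [hr]; field_simp
  have hr0 : 0 < r := div_pos (by linarith) hθp
  have hr1 : r ≤ 1 := by rw [hr, div_le_one hθp]; linarith
  refine ⟨2 ^ (J + 2), fun n => ?_⟩
  rcases lt_or_ge n (2 ^ (J + 2)) with hn | hn
  · have h1 : (n:ℝ) ≤ 2 ^ (J + 2) := by exact_mod_cast hn.le
    have h2 : (0:ℝ) ≤ freeCount lam n := by positivity
    have h3 : (0:ℝ) ≤ n := by positivity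
    nlinarith
  · have hn0 : n ≠ 0 := by have : 0 < 2 ^ (J + 2) := by positivity
                           omega
    have hj : J + 2 ≤ Nat.log 2 n := Nat.le_log_of_pow_le (by norm_num) hn
    have hb := hblock _ hj n (Nat.pow_log_le_self 2 hn0)
      (Nat.lt_pow_succ_log_self (by norm_num) n).le
    have hi := hind _ hj
    rw [hFK]
    set P : ℝ := 2 ^ (Nat.log 2 n)
    have m1 := min_le_left ((n:ℝ) - P) (θ * P)
    have m2 := min_le_right ((n:ℝ) - P) (θ * P)
    rcases le_total (n:ℝ) (P * (1 + θ)) with hc | hc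
    · have := mul_le_mul_of_nonneg_left hc hr0.le
      nlinarith
    · have := mul_le_mul_of_nonneg_left hc (by linarith : 0 ≤ 1 - r)
      nlinarith

/-- Fair coin. -/
def coin : Measure Bool := (2⁻¹ : ℝ≥0∞) • Measure.dirac true + (2⁻¹ : ℝ≥0∞) • Measure.dirac false

instance coin_prob : IsProbabilityMeasure coin := by
  constructor
  simp [coin, ENNReal.inv_two_add_inv_two]

lemma coin_singleton (c : Bool) : coin {c} = 2⁻¹ := by
  cases c <;> simp [coin]

/-- Product of fair coins. -/
def coins : Measure (ℕ → Bool) := Measure.infinitePi (fun _ : ℕ => coin)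

instance coins_prob : IsProbabilityMeasure coins := by
  unfold coins; infer_instance

open Classical in
/-- Digits with zeros imposed on `K`. -/
def dig (lam : ℝ) (b : ℕ → Bool) (i : ℕ) : ℕ := if i ∈ Kset lam 1 then 0 else (b i).toNat

lemma dig_le (lam : ℝ) (b : ℕ → Bool) (i : ℕ) : dig lam b i ≤ 1 := by
  unfold dig; split_ifs
  · omega
  · exact Bool.toNat_le _

/-- The parametrisation of `S`. -/
def Phi (lam : ℝ) (b : ℕ → Bool) : AddCircle (1:ℝ) := ((vv (dig lam b) : ℝ) : AddCircle (1:ℝ))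

lemma Phi_continuous (lam : ℝ) : Continuous (Phi lam) := by
  refine (AddCircle.continuous_mk' 1).comp ?_
  unfold vv
  refine continuous_tsum (fun i => ?_) hasSum_half.summable (fun i b => ?_)
  · have : Continuous (fun b : ℕ → Bool => dig lam b i) := by
      unfold dig
      split_ifs
      · exact continuous_const
      · exact (continuous_of_discreteTopology (f := Bool.toNat)).comp (continuous_apply i)
    exact ((continuous_of_discreteTopology (f := fun m : ℕ => (m:ℝ))).comp this).div_const _
  · rw [Real.norm_of_nonneg (by positivity)]
    have : (dig lam b i : ℝ) ≤ 1 := by exact_mod_cast dig_le lam b i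
    gcongr

lemma Phi_mem (lam : ℝ) (b : ℕ → Bool) : Phi lam b ∈ Sset lam 1 := by
  refine ⟨dig lam b, dig_le lam b, fun i hi => ?_, rfl⟩
  simp [dig, hi]

lemma coins_cyl (lam : ℝ) (n : ℕ) (t : ℤ) :
    coins {b | (av (dig lam b) n : ℤ) = t} ≤ (2⁻¹ : ℝ≥0∞) ^ freeCount lam n := by
  classical
  rcases Set.eq_empty_or_nonempty {b | (av (dig lam b) n : ℤ) = t} with h | ⟨b1, hb1⟩
  · rw [h]; simp
  · have hsub : {b | (av (dig lam b) n : ℤ) = t} ⊆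
        Set.pi ((Finset.range n).filter (fun i => i ∉ Kset lam 1) : Finset ℕ)
          (fun i => {b1 i}) := by
      intro b hb i hi
      rw [Finset.mem_coe, Finset.mem_filter, Finset.mem_range] at hi
      have he : av (dig lam b) n = av (dig lam b1) n := by
        have : (av (dig lam b) n : ℤ) = av (dig lam b1) n := by
          exact Eq.trans hb (Eq.symm hb1)
        exact_mod_cast this
      have := av_inj _ _ (dig_le lam b) (dig_le lam b1) n he i hi.1
      simp only [dig, if_neg hi.2] at this
      show b i = b1 i
      revert this
      cases b i <;> cases b1 i <;> simp
    refine (measure_mono hsub).trans ?_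
    rw [coins, Measure.infinitePi_pi _ (fun i _ => measurableSet_singleton _)]
    simp only [coin_singleton, Finset.prod_const]
    unfold freeCount
    exact le_of_eq (by congr!)

lemma coins_small (lam : ℝ) (n : ℕ) (s : Set (AddCircle (1:ℝ)))
    (hs : ∀ x ∈ s, ∀ y ∈ s, dist x y ≤ 1 / 2 ^ n) :
    coins (Phi lam ⁻¹' s) ≤ 15 * (2⁻¹ : ℝ≥0∞) ^ freeCount lam n := by
  classical
  rcases Set.eq_empty_or_nonempty (Phi lam ⁻¹' s) with h | ⟨b0, hb0⟩
  · rw [h]; simp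
  set T : Finset ℤ := ((Finset.Icc (-1:ℤ) 1) ×ˢ (Finset.Icc (-2:ℤ) 2)).image
    (fun p => (av (dig lam b0) n : ℤ) + p.1 * 2 ^ n + p.2) with hT
  have hcard : T.card ≤ 15 := by
    refine Finset.card_image_le.trans ?_
    rw [Finset.card_product]; simp
  have hsub : Phi lam ⁻¹' s ⊆ ⋃ t ∈ T, {b | (av (dig lam b) n : ℤ) = t} := by
    intro b hb
    have hd := hs _ hb _ hb0
    unfold Phi at hd
    rw [dist_eq_norm, ← AddCircle.coe_sub] at hd
    have hn := AddCircle.norm_eq (p := 1) (x := vv (dig lam b) - vv (dig lam b0))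
    simp only [inv_one, one_mul, mul_one] at hn
    rw [hn] at hd
    set z := round (vv (dig lam b) - vv (dig lam b0))
    have hz : |vv (dig lam b) - vv (dig lam b0) - z| ≤ 1 / 2 := abs_sub_round _
    have p1 := vv_split _ (dig_le lam b) n
    have p0 := vv_split _ (dig_le lam b0) n
    have u1 := vv_nonneg (fun i => dig lam b (n + i))
    have u2 := vv_le_one (fun i => dig lam b (n + i)) (fun i => dig_le lam b _)
    have u3 := vv_nonneg (fun i => dig lam b0 (n + i))
    have u4 := vv_le_one (fun i => dig lam b0 (n + i)) (fun i => dig_le lam b0 _)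
    have w1 := vv_nonneg (dig lam b)
    have w2 := vv_le_one _ (dig_le lam b)
    have w3 := vv_nonneg (dig lam b0)
    have w4 := vv_le_one _ (dig_le lam b0)
    have h2n : (0:ℝ) < 2 ^ n := by positivity
    rw [eq_div_iff h2n.ne'] at p1 p0
    rw [le_div_iff₀ h2n, ← abs_of_pos h2n, ← abs_mul, abs_le] at hd
    rw [abs_le] at hz
    have hz1 : (z:ℝ) < 2 := by linarith
    have hz2 : (-2:ℝ) < z := by linarith
    have hz1' : z < 2 := by exact_mod_cast hz1
    have hz2' : -2 < z := by exact_mod_cast hz2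
    have d1 : ((av (dig lam b) n : ℤ) - (av (dig lam b0) n : ℤ) - z * 2 ^ n : ℝ) ≤ 2 := by
      have hd2 := hd.2
      rw [sub_mul, sub_mul, p1, p0] at hd2
      push_cast; linarith
    have d2 : (-2 : ℝ) ≤ ((av (dig lam b) n : ℤ) - (av (dig lam b0) n : ℤ) - z * 2 ^ n : ℝ) := by
      have hd1 := hd.1
      rw [sub_mul, sub_mul, p1, p0] at hd1
      push_cast; linarith
    have d1' : (av (dig lam b) n : ℤ) - (av (dig lam b0) n : ℤ) - z * 2 ^ n ≤ 2 := by
      exact_mod_cast d1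
    have d2' : -2 ≤ (av (dig lam b) n : ℤ) - (av (dig lam b0) n : ℤ) - z * 2 ^ n := by
      exact_mod_cast d2
    refine mem_iUnion₂.2 ⟨_, ?_, rfl⟩
    rw [hT, Finset.mem_image]
    refine ⟨(z, (av (dig lam b) n : ℤ) - (av (dig lam b0) n : ℤ) - z * 2 ^ n), ?_, by
      simp only; ring⟩
    rw [Finset.mem_product, Finset.mem_Icc, Finset.mem_Icc]
    exact ⟨⟨by simp only; omega, by simp only; omega⟩, ⟨d2', d1'⟩⟩
  calc coins (Phi lam ⁻¹' s) ≤ _ := measure_mono hsub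
    _ ≤ ∑ t ∈ T, coins {b | (av (dig lam b) n : ℤ) = t} := measure_biUnion_finset_le _ _
    _ ≤ ∑ t ∈ T, (2⁻¹ : ℝ≥0∞) ^ freeCount lam n := Finset.sum_le_sum fun t _ => coins_cyl lam n t
    _ = T.card * (2⁻¹ : ℝ≥0∞) ^ freeCount lam n := by rw [Finset.sum_const, nsmul_eq_mul]
    _ ≤ _ := by gcongr; exact_mod_cast hcard

lemma coins_holder (lam r c : ℝ) (hr : 0 < r)
    (hc : ∀ n : ℕ, r * n - c ≤ freeCount lam n) (δ : ℝ) (hδ : 0 < δ) (hδ1 : δ ≤ 1)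
    (s : Set (AddCircle (1:ℝ))) (hs : ∀ x ∈ s, ∀ y ∈ s, dist x y ≤ δ) :
    coins (Phi lam ⁻¹' s) ≤ ENNReal.ofReal (15 * 2 ^ (c + r) * δ ^ r) := by
  obtain ⟨n, hn1, hn2⟩ := exists_nat_pow_near_of_lt_one hδ hδ1 (y := (1/2:ℝ)) (by norm_num)
    (by norm_num)
  refine (coins_small lam n s (fun x hx y hy => (hs x hx y hy).trans
    (by rw [← one_div_pow]; exact hn2))).trans ?_
  have e : 15 * (2⁻¹ : ℝ≥0∞) ^ freeCount lam n
      = ENNReal.ofReal (15 * (2⁻¹:ℝ) ^ freeCount lam n) := by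
    rw [ENNReal.ofReal_mul (by norm_num), ENNReal.ofReal_pow (by norm_num),
      ENNReal.ofReal_inv_of_pos (by norm_num)]
    simp
  rw [e]
  refine ENNReal.ofReal_le_ofReal ?_
  rw [mul_assoc]
  refine mul_le_mul_of_nonneg_left ?_ (by norm_num)
  have h1 : ((1/2:ℝ) ^ (n + 1)) ^ r ≤ δ ^ r := Real.rpow_le_rpow (by positivity) hn1.le hr.le
  have h2 : (2⁻¹:ℝ) ^ freeCount lam n ≤ 2 ^ (c + r) * ((1/2:ℝ) ^ (n + 1)) ^ r := by
    rw [one_div, inv_pow, inv_pow, ← Real.rpow_natCast, ← Real.rpow_natCast 2 (n + 1),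
      ← Real.rpow_neg (by norm_num), ← Real.rpow_neg (by norm_num), ← Real.rpow_mul (by norm_num),
      ← Real.rpow_add (by norm_num)]
    refine Real.rpow_le_rpow_of_exponent_le (by norm_num) ?_
    have := hc n
    push_cast
    linarith
  refine h2.trans ?_
  gcongr

lemma dim_lower_aux (lam θ : ℝ) (h0 : 0 ≤ lam) (hθ : lam < θ) (hθ1 : θ < 1) :
    ENNReal.ofReal ((1 - θ) / (1 + θ)) ≤ dimH (Sset lam 1) := by
  obtain ⟨c, hc⟩ := freeCount_lower lam θ h0 hθ hθ1
  have hr : 0 < (1 - θ) / (1 + θ) := div_pos (by linarith) (by linarith)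
  set r := (1 - θ) / (1 + θ)
  set C : ℝ := 15 * 2 ^ (c + r) with hC
  have hCpos : 0 < C := by positivity
  have hmeas : Measurable (Phi lam) := (Phi_continuous lam).measurable
  set μ : Measure (AddCircle (1:ℝ)) := (ENNReal.ofReal C)⁻¹ • coins.map (Phi lam) with hμ
  have hC0 : ENNReal.ofReal C ≠ 0 := by simpa using hCpos
  have hCt : ENNReal.ofReal C ≠ ∞ := ENNReal.ofReal_ne_top
  have hle : μ ≤ μH[r] := by
    refine Measure.le_hausdorffMeasure r μ 1 one_pos ?_
    intro s hs
    have hmap : coins.map (Phi lam) s ≤ ENNReal.ofReal C * Metric.ediam s ^ r := by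
      refine (measure_mono subset_closure).trans ?_
      rw [Measure.map_apply hmeas isClosed_closure.measurableSet]
      have hne : Metric.ediam s ≠ ∞ := (hs.trans_lt ENNReal.one_lt_top).ne
      have hdist : ∀ x ∈ closure s, ∀ y ∈ closure s, dist x y ≤ (Metric.ediam s).toReal := by
        intro x hx y hy
        rw [dist_edist]
        refine ENNReal.toReal_mono hne ?_
        rw [← Metric.ediam_closure]
        exact Metric.edist_le_ediam_of_mem hx hy
      rcases eq_or_ne (Metric.ediam s) 0 with hz | hz
      · rw [hz, ENNReal.zero_rpow_of_pos hr, mul_zero]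
        rw [hz] at hdist
        have t : Tendsto (fun m : ℕ => ENNReal.ofReal (C * ((1/2:ℝ) ^ m) ^ r)) atTop (𝓝 0) := by
          have t1 : Tendsto (fun m : ℕ => (1/2:ℝ) ^ m) atTop (𝓝 0) :=
            tendsto_pow_atTop_nhds_zero_of_lt_one (by norm_num) (by norm_num)
          have t2 := (t1.rpow_const (Or.inr hr.le)).const_mul C
          rw [Real.zero_rpow hr.ne', mul_zero] at t2
          simpa using ENNReal.tendsto_ofReal t2
        refine ge_of_tendsto' t fun m => ?_
        refine coins_holder lam r c hr hc _ (by positivity)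
          (pow_le_one₀ (by norm_num) (by norm_num)) _ (fun x hx y hy => (hdist x hx y hy).trans ?_)
        simp
      · have hpos : 0 < (Metric.ediam s).toReal := ENNReal.toReal_pos hz hne
        have h1 : (Metric.ediam s).toReal ≤ 1 := by
          have := ENNReal.toReal_mono ENNReal.one_ne_top hs
          simpa using this
        refine (coins_holder lam r c hr hc _ hpos h1 _ hdist).trans ?_
        rw [← hC, ENNReal.ofReal_mul hCpos.le, ← ENNReal.ofReal_rpow_of_pos hpos,
          ENNReal.ofReal_toReal hne]
    rw [hμ, Measure.smul_apply, smul_eq_mul, mul_comm, ← div_eq_mul_inv]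
    exact ENNReal.div_le_of_le_mul' hmap
  have hne : μH[((r.toNNReal : NNReal) : ℝ)] (Sset lam 1) ≠ 0 := by
    rw [Real.coe_toNNReal _ hr.le]
    refine (lt_of_lt_of_le ?_ (hle (Sset lam 1))).ne'
    rw [hμ, Measure.smul_apply, smul_eq_mul]
    refine ENNReal.mul_pos (by simp) ?_
    have h := Measure.le_map_apply hmeas.aemeasurable (μ := coins) (Sset lam 1)
    have hu : Phi lam ⁻¹' (Sset lam 1) = univ := eq_univ_of_forall fun b => Phi_mem lam b
    rw [hu, measure_univ] at h
    exact (lt_of_lt_of_le one_pos h).ne'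
  exact le_dimH_of_hausdorffMeasure_ne_zero hne

lemma dim_lower (lam : ℝ) (h0 : 0 ≤ lam) :
    ENNReal.ofReal ((1 - lam) / (1 + lam)) ≤ dimH (Sset lam 1) := by
  refine le_of_forall_lt fun t ht => ?_
  obtain ⟨r', hr1, hr2⟩ := exists_between ht
  refine hr1.trans_le ?_
  have hne : r' ≠ ∞ := (hr2.trans_le le_top).ne
  have hr0 : 0 < r'.toReal := ENNReal.toReal_pos (ne_bot_of_gt hr1) hne
  have hrlt : r'.toReal < (1 - lam) / (1 + lam) := by
    have := (ENNReal.lt_ofReal_iff_toReal_lt hne).1 hr2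
    exact this
  set r := r'.toReal with hr
  have hl : 0 < 1 + lam := by linarith
  rw [lt_div_iff₀ hl] at hrlt
  have h1r : 0 < 1 + r := by linarith
  have := dim_lower_aux lam ((1 - r) / (1 + r)) h0
    (by rw [lt_div_iff₀ h1r]; nlinarith) (by rw [div_lt_one h1r]; linarith)
  have e : (1 - (1 - r) / (1 + r)) / (1 + (1 - r) / (1 + r)) = r := by
    field_simp; ring
  rw [e, hr, ENNReal.ofReal_toReal hne] at this
  exact this

lemma S_subset (lam : ℝ) (k : ℕ) (hk : 0 < k) : Sset lam 1 ⊆ kFold1 k (Sset lam 1) := by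
  intro y hy
  refine ⟨fun i => if i = ⟨0, hk⟩ then y else 0, fun i => ?_, by simp⟩
  simp only
  split_ifs
  · exact hy
  · exact ⟨fun _ => 0, by simp, by simp, by simp⟩

/-- Lemma 3.4(3): for every `λ ∈ [0,1]` and positive integer
`k`, `dim(k × S_λ) = (1-λ)/(1+λ)` and `C_{(1-λ)/(1+λ)}(k × S_λ) = 0`. -/
theorem stmt16 (lam : ℝ) (h0 : 0 ≤ lam) (h1 : lam ≤ 1) (k : ℕ) (hk : 0 < k) :
    dimH (kFold1 k (Sset lam 1)) = ENNReal.ofReal ((1 - lam) / (1 + lam)) ∧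
    CapacityZero1 ((1 - lam) / (1 + lam)) (kFold1 k (Sset lam 1)) := by
  rcases lt_or_eq_of_le h1 with h | h
  · exact ⟨le_antisymm (dim_upper lam h0 h k hk)
      ((dim_lower lam h0).trans (dimH_mono (S_subset lam k hk))), capacity_lt lam h0 h k hk⟩
  · subst h
    have e : ((1:ℝ) - 1) / (1 + 1) = 0 := by norm_num
    rw [e]
    exact ⟨by rw [dimH_finite (kfold_one_finite k)]; simp, capacity_one k⟩

end
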